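/- Fix constants l > 0, g > 0, μ > 0, a Lipschitz continuous function a : ℝ → ℝ, and an initial time t₀. Let σ : [0,π] → ℝ be any continuous function with σ(0) < 0 and σ(π) > 0. Then there exists q₀ ∈ [0,π] such that some solution (q(t),p(t)) of the pendulum differential inclusion (q̇,ṗ) ∈ Φ(q,p,t) on [t₀,∞) with q(t₀) = q₀ and p(t₀) = σ(q₀) satisfies q(t) ∈ [0,π] for all t ≥ t₀. -/

import Mathlib

open MeasureTheory Set Filter

noncomputable section

/-- The scalar right-hand side of the pendulum equation for the angular velocity, where
`s ∈ [-1, 1]` is the direction of the dry friction force: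
`h (q, p, t, s) = (a t / l)·sin q − (μ / l)·|a t·cos q − l·p² + g·sin q|·s − (g / l)·cos q`. -/
def hRHS (l g μ : ℝ) (a : ℝ → ℝ) (q p t s : ℝ) : ℝ :=
  (a t / l) * Real.sin q - (μ / l) * |a t * Real.cos q - l * p ^ 2 + g * Real.sin q| * s
    - (g / l) * Real.cos q

/-- The pendulum set-valued map `Φ`: a singleton `{(p, h (q, p, t, p / |p|))}` for `p ≠ 0`,
and the segment `{(0, h (q, 0, t, s)) : s ∈ [−1, 1]}` for `p = 0`. -/
def Phi (l g μ : ℝ) (a : ℝ → ℝ) (q p t : ℝ) : Set (ℝ × ℝ) :=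
  if p ≠ 0 then {(p, hRHS l g μ a q p t (p / |p|))}
  else {v : ℝ × ℝ | ∃ s ∈ Set.Icc (-1 : ℝ) 1, v = (0, hRHS l g μ a q 0 t s)}

/-- `x` is a solution of the differential inclusion `ẋ ∈ F (x, t)` (in the plane) on the
time interval `I` containing `t₀`: there is a locally integrable `v` with
`x t = x t₀ + ∫_{t₀}^t v` on `I` and `v t ∈ F (x t) t` for a.e. `t ∈ I`. -/
def IsDISolution (F : ℝ × ℝ → ℝ → Set (ℝ × ℝ)) (I : Set ℝ) (t₀ : ℝ)
    (x : ℝ → ℝ × ℝ) : Prop :=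
  ∃ v : ℝ → ℝ × ℝ, LocallyIntegrable v volume ∧
    (∀ t ∈ I, x t = x t₀ + ∫ s in t₀..t, v s) ∧
    (∀ᵐ t ∂(volume.restrict I), v t ∈ F (x t) t)

/-- floor index -/
def flr (t₀ : ℝ) (h : ℕ → ℝ) (n : ℕ) (t : ℝ) : ℕ := ⌊(t - t₀) / h n⌋₊

/-- the filter of grid points near `t` -/
def lf (t₀ : ℝ) (h : ℕ → ℝ) (t : ℝ) : Filter (ℕ × ℕ) :=
  Filter.comap (fun z : ℕ × ℕ => (z.1, t₀ + z.2 * h z.1)) ((hyperfilter ℕ : Filter ℕ) ×ˢ nhds t)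

lemma flr_le {t₀ t : ℝ} {h : ℕ → ℝ} (hpos : ∀ n, 0 < h n) (ht : t₀ ≤ t) (n : ℕ) :
    t₀ + flr t₀ h n t * h n ≤ t := by
  have := Nat.floor_le (a := (t - t₀) / h n) (div_nonneg (by linarith) (hpos n).le)
  rw [le_div_iff₀ (hpos n)] at this
  unfold flr; linarith

lemma lt_flr {t₀ t : ℝ} {h : ℕ → ℝ} (hpos : ∀ n, 0 < h n) (n : ℕ) :
    t < t₀ + flr t₀ h n t * h n + h n := by
  have := Nat.lt_floor_add_one ((t - t₀) / h n)
  rw [div_lt_iff₀ (hpos n)] at this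
  unfold flr; linarith

lemma hyp_tendsto {h : ℕ → ℝ} (h0 : Tendsto h atTop (nhds 0)) :
    Tendsto h (hyperfilter ℕ : Filter ℕ) (nhds 0) := h0.mono_left Nat.hyperfilter_le_atTop

lemma flr_tendsto {t₀ t : ℝ} {h : ℕ → ℝ} (hpos : ∀ n, 0 < h n) (h0 : Tendsto h atTop (nhds 0))
    (ht : t₀ ≤ t) :
    Tendsto (fun n => t₀ + flr t₀ h n t * h n) (hyperfilter ℕ : Filter ℕ) (nhds t) := by
  have h1 : Tendsto (fun n => t - h n) (hyperfilter ℕ : Filter ℕ) (nhds t) := by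
    simpa using (hyp_tendsto h0).const_sub t
  refine tendsto_of_tendsto_of_tendsto_of_le_of_le h1 tendsto_const_nhds ?_ ?_
  · intro n
    have := lt_flr (t₀ := t₀) (t := t) hpos n
    simp only; linarith
  · intro n; exact flr_le hpos ht n

lemma flr_lf {t₀ t : ℝ} {h : ℕ → ℝ} (hpos : ∀ n, 0 < h n) (h0 : Tendsto h atTop (nhds 0))
    (ht : t₀ ≤ t) :
    Tendsto (fun n => (n, flr t₀ h n t)) (hyperfilter ℕ : Filter ℕ) (lf t₀ h t) := by
  unfold lf
  rw [tendsto_comap_iff]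
  exact tendsto_id.prodMk (flr_tendsto hpos h0 ht)

lemma lf_fst {t₀ t : ℝ} {h : ℕ → ℝ} :
    Tendsto (fun z : ℕ × ℕ => z.1) (lf t₀ h t) (hyperfilter ℕ : Filter ℕ) :=
  (tendsto_fst (g := nhds t)).comp (tendsto_comap (f := fun z : ℕ × ℕ => (z.1, t₀ + z.2 * h z.1)))

lemma lf_time {t₀ t : ℝ} {h : ℕ → ℝ} :
    Tendsto (fun z : ℕ × ℕ => t₀ + z.2 * h z.1) (lf t₀ h t) (nhds t) :=
  (tendsto_snd (f := (hyperfilter ℕ : Filter ℕ))).comp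
    (tendsto_comap (f := fun z : ℕ × ℕ => (z.1, t₀ + z.2 * h z.1)))

lemma lf_h {t₀ t : ℝ} {h : ℕ → ℝ} (h0 : Tendsto h atTop (nhds 0)) :
    Tendsto (fun z : ℕ × ℕ => h z.1) (lf t₀ h t) (nhds 0) :=
  (hyp_tendsto h0).comp lf_fst

lemma lf_shift {t₀ t : ℝ} {h : ℕ → ℝ} (h0 : Tendsto h atTop (nhds 0)) :
    Tendsto (fun z : ℕ × ℕ => (z.1, z.2 + 1)) (lf t₀ h t) (lf t₀ h t) := by
  conv_rhs => unfold lf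
  rw [tendsto_comap_iff]
  refine lf_fst.prodMk ?_
  have := (lf_time (t₀ := t₀) (t := t) (h := h)).add (lf_h (t₀ := t₀) (t := t) h0)
  rw [add_zero] at this
  refine this.congr ?_
  intro z; push_cast; ring

lemma lf_extract {t₀ t : ℝ} {h : ℕ → ℝ} {R : ℕ × ℕ → Prop} (hR : ∀ᶠ z in lf t₀ h t, R z) :
    ∃ δ > 0, ∀ᶠ n in (hyperfilter ℕ : Filter ℕ), ∀ k : ℕ, |t₀ + k * h n - t| < δ → R (n, k) := by
  unfold lf at hR
  rw [Filter.eventually_comap] at hR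
  obtain ⟨pa, ha, pb, hb, hab⟩ := Filter.eventually_prod_iff.1 hR
  obtain ⟨δ, hδ, hb⟩ := Metric.eventually_nhds_iff.1 hb
  refine ⟨δ, hδ, ?_⟩
  filter_upwards [ha] with n hn k hk
  exact hab hn (hb (by rwa [Real.dist_eq])) (n, k) rfl

lemma lip_disc {t₀ T M : ℝ} {h : ℕ → ℝ} (hpos : ∀ n, 0 < h n) {Y : ℕ → ℕ → ℝ}
    (hM : ∀ n (k : ℕ), t₀ + (k + 1) * h n ≤ T → |Y n (k + 1) - Y n k| ≤ M * h n) (n j k : ℕ)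
    (hjk : j ≤ k) (hk : t₀ + k * h n ≤ T) : |Y n k - Y n j| ≤ M * |k * h n - j * h n| := by
  have key : |Y n k - Y n j| ≤ M * ((k - j) * h n) := by
    induction k, hjk using Nat.le_induction with
    | base => simp
    | succ k hjk ih =>
      push_cast at hk ⊢
      have h1 := ih (by nlinarith [hpos n])
      have h2 := hM n k hk
      calc |Y n (k + 1) - Y n j| = |(Y n (k + 1) - Y n k) + (Y n k - Y n j)| := by ring_nf
        _ ≤ _ := abs_add_le _ _
        _ ≤ M * h n + M * ((k - j) * h n) := add_le_add h2 h1
        _ = _ := by ring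
  have : (j : ℝ) ≤ k := by exact_mod_cast hjk
  rw [abs_of_nonneg (a := (k : ℝ) * h n - j * h n) (by nlinarith [hpos n])]
  rw [sub_mul] at key
  exact key

lemma lip_disc' {t₀ T M : ℝ} {h : ℕ → ℝ} (hpos : ∀ n, 0 < h n) {Y : ℕ → ℕ → ℝ}
    (hM : ∀ n (k : ℕ), t₀ + (k + 1) * h n ≤ T → |Y n (k + 1) - Y n k| ≤ M * h n) (n j k : ℕ)
    (hj : t₀ + j * h n ≤ T) (hk : t₀ + k * h n ≤ T) :
    |Y n k - Y n j| ≤ M * |k * h n - j * h n| := by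
  rcases le_total j k with hjk | hjk
  · exact lip_disc hpos hM n j k hjk hk
  · rw [abs_sub_comm, abs_sub_comm (k * h n)]
    exact lip_disc hpos hM n k j hjk hj

lemma incr_disc {h c : ℝ} {Y : ℕ → ℝ} (j k : ℕ) (hjk : j ≤ k)
    (hc : ∀ i, j ≤ i → i < k → Y (i + 1) - Y i ≤ h * c) :
    Y k - Y j ≤ (k * h - j * h) * c := by
  induction k, hjk using Nat.le_induction with
  | base => simp
  | succ k hjk ih =>
    have h1 := ih (fun i hi hik => hc i hi (by omega))
    have h2 := hc k hjk (by omega)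
    push_cast; linarith

lemma limit_lemma (t₀ : ℝ) (h : ℕ → ℝ) (hpos : ∀ n, 0 < h n) (h0 : Tendsto h atTop (nhds 0))
    (Y : ℕ → ℕ → ℝ) (S : ℝ) (hS : ∀ n, |Y n 0| ≤ S)
    (hM : ∀ T, ∃ M, 0 ≤ M ∧ ∀ n (k : ℕ), t₀ + (k + 1) * h n ≤ T →
      |Y n (k + 1) - Y n k| ≤ M * h n) :
    ∃ y : ℝ → ℝ, (∀ T, ∃ M, 0 ≤ M ∧ ∀ s ≤ T, ∀ t ≤ T, |y s - y t| ≤ M * |s - t|) ∧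
      ∀ t ≥ t₀, Tendsto (fun z : ℕ × ℕ => Y z.1 z.2) (lf t₀ h t) (nhds (y t)) := by
  have ex : ∀ t, ∃ r, Tendsto (fun n => Y n (flr t₀ h n (max t t₀)))
      (hyperfilter ℕ : Filter ℕ) (nhds r) := by
    intro t
    obtain ⟨M, hM0, hM⟩ := hM (max t t₀)
    have hb : ∀ n, Y n (flr t₀ h n (max t t₀)) ∈
        Icc (-(S + M * (max t t₀ - t₀))) (S + M * (max t t₀ - t₀)) := by
      intro n
      have hle := flr_le hpos (le_max_right t t₀) n
      have h1 := lip_disc hpos hM n 0 _ (Nat.zero_le _) hle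
      have hnn : 0 ≤ (flr t₀ h n (max t t₀) : ℝ) * h n := mul_nonneg (by positivity) (hpos n).le
      rw [Nat.cast_zero, zero_mul, sub_zero, abs_of_nonneg hnn] at h1
      have h2 : M * (flr t₀ h n (max t t₀) * h n) ≤ M * (max t t₀ - t₀) :=
        mul_le_mul_of_nonneg_left (by linarith) hM0
      have h3 := abs_le.1 h1
      have h4 := abs_le.1 (hS n)
      constructor <;> linarith
    obtain ⟨r, -, hr⟩ := isCompact_Icc.ultrafilter_le_nhds
      ((hyperfilter ℕ).map (fun n => Y n (flr t₀ h n (max t t₀))))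
      (by
        rw [Ultrafilter.coe_map, Filter.le_principal_iff]
        exact Filter.mem_map.2 (Filter.univ_mem' hb))
    exact ⟨r, hr⟩
  choose y hy using ex
  refine ⟨y, ?_, ?_⟩
  · intro T
    obtain ⟨M, hM0, hM⟩ := hM (max T t₀)
    refine ⟨M, hM0, fun s hs t ht => ?_⟩
    have e1 : Tendsto (fun n => |Y n (flr t₀ h n (max s t₀)) - Y n (flr t₀ h n (max t t₀))|)
      (hyperfilter ℕ : Filter ℕ) (nhds |y s - y t|) := ((hy s).sub (hy t)).abs
    have e2 : Tendsto (fun n => M * |(t₀ + flr t₀ h n (max s t₀) * h n) -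
        (t₀ + flr t₀ h n (max t t₀) * h n)|)
      (hyperfilter ℕ : Filter ℕ) (nhds (M * |max s t₀ - max t t₀|)) :=
      (((flr_tendsto hpos h0 (le_max_right _ _)).sub
        (flr_tendsto hpos h0 (le_max_right _ _))).abs).const_mul M
    have e3 := le_of_tendsto_of_tendsto' e1 e2 (fun n => by
      have := lip_disc' hpos hM n (flr t₀ h n (max t t₀)) (flr t₀ h n (max s t₀))
        ((flr_le hpos (le_max_right _ _) n).trans (max_le_max_right _ ht))
        ((flr_le hpos (le_max_right _ _) n).trans (max_le_max_right _ hs))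
      rwa [add_sub_add_left_eq_sub])
    exact e3.trans (mul_le_mul_of_nonneg_left (abs_max_sub_max_le_abs _ _ _) hM0)
  · intro t ht
    have hyt := hy t
    rw [max_eq_left ht] at hyt
    obtain ⟨M, hM0, hM⟩ := hM (t + 1)
    have e1 : Tendsto (fun z : ℕ × ℕ => Y z.1 (flr t₀ h z.1 t)) (lf t₀ h t) (nhds (y t)) :=
      hyt.comp lf_fst
    have e2 : Tendsto (fun z : ℕ × ℕ => t₀ + (flr t₀ h z.1 t) * h z.1) (lf t₀ h t) (nhds t) :=
      (flr_tendsto hpos h0 ht).comp lf_fst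
    have e3 : Tendsto (fun z : ℕ × ℕ => M * |(t₀ + z.2 * h z.1) - (t₀ + (flr t₀ h z.1 t) * h z.1)|)
        (lf t₀ h t) (nhds 0) := by
      have := ((lf_time.sub e2).abs).const_mul M
      simpa using this
    have e4 : Tendsto (fun z : ℕ × ℕ => Y z.1 z.2 - Y z.1 (flr t₀ h z.1 t)) (lf t₀ h t)
        (nhds 0) := by
      refine squeeze_zero_norm' ?_ e3
      filter_upwards [lf_time.eventually (gt_mem_nhds (show t < t + 1 by linarith))] with z hz
      rw [add_sub_add_left_eq_sub, Real.norm_eq_abs]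
      exact lip_disc' hpos hM _ _ _ ((flr_le hpos ht _).trans (by linarith)) hz.le
    simpa using e4.add e1

lemma upper_deriv {t₀ : ℝ} {h : ℕ → ℝ} (hpos : ∀ n, 0 < h n) (h0 : Tendsto h atTop (nhds 0))
    {Y : ℕ → ℕ → ℝ} {y : ℝ → ℝ}
    (hy : ∀ t ≥ t₀, Tendsto (fun z : ℕ × ℕ => Y z.1 z.2) (lf t₀ h t) (nhds (y t)))
    {t : ℝ} (ht : t₀ ≤ t) {U d : ℝ}
    (hU : ∀ η > 0, ∀ᶠ z in lf t₀ h t, Y z.1 (z.2 + 1) - Y z.1 z.2 ≤ h z.1 * (U + η))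
    (hd : HasDerivAt y d t) : d ≤ U := by
  refine le_of_forall_pos_le_add fun η hη => ?_
  obtain ⟨δ, hδ, hn⟩ := lf_extract (hU η hη)
  have hsl := (hasDerivAt_iff_tendsto_slope.1 hd).mono_left
    (nhdsWithin_mono t (show Ioi t ⊆ {t}ᶜ from fun s hs => ne_of_gt hs))
  refine le_of_tendsto hsl ?_
  filter_upwards [Ioo_mem_nhdsGT (show t < t + δ by linarith)] with s hs
  rw [slope_def_field, div_le_iff₀ (by linarith [hs.1])]
  have hs0 : t₀ ≤ s := by linarith [hs.1]
  have c1 := ((hy s hs0).comp (flr_lf hpos h0 hs0)).sub ((hy t ht).comp (flr_lf hpos h0 ht))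
  have c2 := ((flr_tendsto hpos h0 hs0).sub (flr_tendsto hpos h0 ht)).mul_const (U + η)
  rw [mul_comm]
  refine le_of_tendsto_of_tendsto c1 c2 ?_
  filter_upwards [hn, (hyp_tendsto h0).eventually (gt_mem_nhds hδ)] with n hn hhn
  simp only [Function.comp]
  rw [add_sub_add_left_eq_sub]
  have hmono : flr t₀ h n t ≤ flr t₀ h n s := by
    unfold flr
    exact Nat.floor_mono (div_le_div_of_nonneg_right (by linarith [hs.1]) (hpos n).le)
  refine incr_disc _ _ hmono (fun i hi1 hi2 => hn i ?_)
  have i1 : (flr t₀ h n t : ℝ) * h n ≤ i * h n :=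
    mul_le_mul_of_nonneg_right (by exact_mod_cast hi1) (hpos n).le
  have i2 : (i : ℝ) * h n ≤ flr t₀ h n s * h n :=
    mul_le_mul_of_nonneg_right (by exact_mod_cast hi2.le) (hpos n).le
  have i3 := flr_le hpos hs0 n
  have i4 := lt_flr (t₀ := t₀) (t := t) hpos n
  rw [abs_lt]
  constructor <;> linarith [hs.2]

lemma lower_deriv {t₀ : ℝ} {h : ℕ → ℝ} (hpos : ∀ n, 0 < h n) (h0 : Tendsto h atTop (nhds 0))
    {Y : ℕ → ℕ → ℝ} {y : ℝ → ℝ}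
    (hy : ∀ t ≥ t₀, Tendsto (fun z : ℕ × ℕ => Y z.1 z.2) (lf t₀ h t) (nhds (y t)))
    {t : ℝ} (ht : t₀ ≤ t) {L d : ℝ}
    (hL : ∀ η > 0, ∀ᶠ z in lf t₀ h t, h z.1 * (L - η) ≤ Y z.1 (z.2 + 1) - Y z.1 z.2)
    (hd : HasDerivAt y d t) : L ≤ d := by
  have := upper_deriv (Y := fun n k => - Y n k) (y := fun t => - y t) (U := -L) (d := -d) hpos h0
    (fun t ht => (hy t ht).neg) ht (fun η hη => (hL η hη).mono fun z hz => by
      linarith) hd.neg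
  linarith

lemma ac_of_lip {y : ℝ → ℝ}
    (hy : ∀ T, ∃ M, 0 ≤ M ∧ ∀ s ≤ T, ∀ t ≤ T, |y s - y t| ≤ M * |s - t|) (α β : ℝ) :
    AbsolutelyContinuousOnInterval y α β := by
  obtain ⟨M, hM0, hM⟩ := hy (max α β)
  refine LipschitzOnWith.absolutelyContinuousOnInterval (K := ⟨M, hM0⟩) ?_
  refine LipschitzOnWith.of_dist_le_mul fun s hs t ht => ?_
  rw [Real.dist_eq, Real.dist_eq]
  exact hM s hs.2 t ht.2

lemma locInt_deriv {y : ℝ → ℝ} (hy : ∀ α β, AbsolutelyContinuousOnInterval y α β) :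
    LocallyIntegrable (deriv y) volume := by
  intro x
  refine ⟨Ioc (x - 1) (x + 1), Ioc_mem_nhds (by linarith) (by linarith), ?_⟩
  have := (hy (x - 1) (x + 1)).intervalIntegrable_deriv
  rwa [intervalIntegrable_iff_integrableOn_Ioc_of_le (by linarith)] at this

lemma ae_diff {y : ℝ → ℝ} (hy : ∀ α β, AbsolutelyContinuousOnInterval y α β) :
    ∀ᵐ t : ℝ, DifferentiableAt ℝ y t := by
  have : ∀ n : ℕ, ∀ᵐ t : ℝ, t ∈ uIcc (-(n : ℝ)) n → DifferentiableAt ℝ y t :=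
    fun n => (hy _ _).ae_differentiableAt
  filter_upwards [ae_all_iff.2 this] with t ht
  obtain ⟨n, hn⟩ := exists_nat_ge |t|
  refine ht n ?_
  rw [uIcc_of_le (by linarith [abs_nonneg t])]
  exact abs_le.1 hn

/-- drive -/
def Ad (l g : ℝ) (a : ℝ → ℝ) (q t : ℝ) : ℝ := (a t / l) * Real.sin q - (g / l) * Real.cos q

/-- friction -/
def Cd (l g μ : ℝ) (a : ℝ → ℝ) (q p t : ℝ) : ℝ :=
  (μ / l) * |a t * Real.cos q - l * p ^ 2 + g * Real.sin q|

/-- clamp -/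
def clp (c p : ℝ) : ℝ := max (-c) (min p c)

lemma clp_abs {c : ℝ} (hc : 0 ≤ c) (p : ℝ) : |clp c p| ≤ c := by
  unfold clp
  exact abs_le.2 ⟨le_max_left _ _, max_le (by linarith) (min_le_right _ _)⟩

lemma clp_nonneg {c p : ℝ} (hc : 0 ≤ c) (hp : 0 ≤ p) : 0 ≤ clp c p ∧ clp c p ≤ p := by
  unfold clp
  exact ⟨le_max_of_le_right (le_min hp hc), max_le (by linarith) (min_le_left _ _)⟩

lemma clp_nonpos {c p : ℝ} (hc : 0 ≤ c) (hp : p ≤ 0) : p ≤ clp c p ∧ clp c p ≤ 0 := by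
  unfold clp
  rw [min_eq_left (by linarith)]
  exact ⟨le_max_right _ _, max_le (by linarith) hp⟩

lemma clp_sub_abs {c : ℝ} (hc : 0 ≤ c) (p : ℝ) : |p - clp c p| ≤ |p| := by
  rcases le_total 0 p with hp | hp
  · have := clp_nonneg hc hp
    rw [abs_of_nonneg hp, abs_of_nonneg (by linarith)]; linarith
  · have := clp_nonpos hc hp
    rw [abs_of_nonpos hp, abs_of_nonpos (by linarith)]; linarith

lemma clp_big {c p : ℝ} (hc : 0 ≤ c) (hp : c ≤ p) : clp c p = c := by
  unfold clp
  rw [min_eq_right hp, max_eq_right (by linarith)]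

lemma clp_small {c p : ℝ} (hp : p ≤ -c) : clp c p = -c := by
  unfold clp
  exact max_eq_left ((min_le_left _ _).trans hp)

/-- one step, momentum -/
def stp (l g μ : ℝ) (a : ℝ → ℝ) (h t q p : ℝ) : ℝ :=
  p - clp (h * Cd l g μ a q p t) p + h * Ad l g a q t

/-- the scheme -/
def sch (l g μ : ℝ) (a : ℝ → ℝ) (t₀ h : ℝ) (x : ℝ × ℝ) : ℕ → ℝ × ℝ
  | 0 => x
  | k + 1 =>
    ((sch l g μ a t₀ h x k).1 + h * stp l g μ a h (t₀ + k * h) (sch l g μ a t₀ h x k).1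
        (sch l g μ a t₀ h x k).2,
      stp l g μ a h (t₀ + k * h) (sch l g μ a t₀ h x k).1 (sch l g μ a t₀ h x k).2)

lemma Cd_nonneg {l g μ : ℝ} (hl : 0 < l) (hμ : 0 < μ) (a : ℝ → ℝ) (q p t : ℝ) :
    0 ≤ Cd l g μ a q p t := by
  unfold Cd; positivity

lemma sch_cont (l g μ : ℝ) (a : ℝ → ℝ) (t₀ h : ℝ) (k : ℕ) :
    Continuous (fun x => sch l g μ a t₀ h x k) := by
  induction k with
  | zero => exact continuous_id
  | succ k ih =>
    unfold sch stp clp Cd Ad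
    fun_prop

lemma exists_stay {l g μ : ℝ} (hl : 0 < l) (hg : 0 < g) (hμ : 0 < μ)
    (a : ℝ → ℝ) (t₀ h : ℝ) (hh : 0 < h) (σ : ℝ → ℝ) (hσ : Continuous σ)
    (hσ0 : σ 0 < 0) (hσπ : σ Real.pi > 0) :
    ∃ q₀ ∈ Icc (0 : ℝ) Real.pi, ∀ k, (sch l g μ a t₀ h (q₀, σ q₀) k).1 ∈ Icc (0 : ℝ) Real.pi := by
  set X : ℝ → ℕ → ℝ × ℝ := fun q₀ k => sch l g μ a t₀ h (q₀, σ q₀) k with hX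
  have hcont : ∀ k, Continuous (fun q => (X q k).1) := fun k =>
    continuous_fst.comp ((sch_cont l g μ a t₀ h k).comp (continuous_id.prodMk hσ))
  have hX0 : ∀ q, X q 0 = (q, σ q) := fun q => rfl
  have hq : ∀ q k, (X q (k + 1)).1 = (X q k).1 + h * (X q (k + 1)).2 := fun q k => rfl
  have hp : ∀ q k, (X q (k + 1)).2 = stp l g μ a h (t₀ + k * h) (X q k).1 (X q k).2 :=
    fun q k => rfl
  have hgl : 0 < h * (g / l) := by positivity
  have up : ∀ q k, (X q k).1 = Real.pi → 0 ≤ (X q k).2 → Real.pi < (X q (k + 1)).1 := by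
    intro q k h1 h2
    have : 0 < (X q (k + 1)).2 := by
      rw [hp, stp, Ad, h1, Real.sin_pi, Real.cos_pi]
      have := clp_nonneg (mul_nonneg hh.le (Cd_nonneg (g := g) hl hμ a Real.pi (X q k).2 (t₀ + k * h))) h2
      linarith
    rw [hq, h1]; nlinarith
  have dn : ∀ q k, (X q k).1 = 0 → (X q k).2 ≤ 0 → (X q (k + 1)).1 < 0 := by
    intro q k h1 h2
    have : (X q (k + 1)).2 < 0 := by
      rw [hp, stp, Ad, h1, Real.sin_zero, Real.cos_zero]
      have := clp_nonpos (mul_nonneg hh.le (Cd_nonneg (g := g) hl hμ a 0 (X q k).2 (t₀ + k * h))) h2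
      linarith
    rw [hq, h1]; nlinarith
  have hpi := Real.pi_pos
  by_contra hcon
  push Not at hcon
  let u : Set ℝ := ⋃ n : ℕ, {q | (X q n).1 < 0 ∧ ∀ m ≤ n, (X q m).1 < Real.pi}
  let v : Set ℝ := ⋃ n : ℕ, {q | Real.pi < (X q n).1 ∧ ∀ m ≤ n, 0 < (X q m).1}
  have hu : IsOpen u := by
    refine isOpen_iUnion fun n => ?_
    have : {q | (X q n).1 < 0 ∧ ∀ m ≤ n, (X q m).1 < Real.pi} =
        {q | (X q n).1 < 0} ∩ ⋂ m ∈ Set.Iic n, {q | (X q m).1 < Real.pi} := by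
      ext q; simp
    rw [this]
    exact (isOpen_lt (hcont n) continuous_const).inter
      ((Set.finite_Iic n).isOpen_biInter fun m _ => isOpen_lt (hcont m) continuous_const)
  have hv : IsOpen v := by
    refine isOpen_iUnion fun n => ?_
    have : {q | Real.pi < (X q n).1 ∧ ∀ m ≤ n, 0 < (X q m).1} =
        {q | Real.pi < (X q n).1} ∩ ⋂ m ∈ Set.Iic n, {q | 0 < (X q m).1} := by
      ext q; simp
    rw [this]
    exact (isOpen_lt continuous_const (hcont n)).inter
      ((Set.finite_Iic n).isOpen_biInter fun m _ => isOpen_lt continuous_const (hcont m))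
  have hcov : Icc 0 Real.pi ⊆ u ∪ v := by
    intro q hq0
    classical
    obtain hex := hcon q hq0
    have hn := Nat.find_spec hex
    have hmin : ∀ m < Nat.find hex, (X q m).1 ∈ Icc (0 : ℝ) Real.pi := fun m hm => by
      have := Nat.find_min hex hm
      push Not at this
      exact this
    set n := Nat.find hex
    have hn' : (X q n).1 ∉ Icc (0 : ℝ) Real.pi := hn
    have cases : (X q n).1 < 0 ∨ Real.pi < (X q n).1 := by
      by_contra hc; push Not at hc; exact hn' hc
    rcases cases with hc | hc
    · left
      refine mem_iUnion.2 ⟨n, hc, fun m hm => ?_⟩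
      rcases hm.lt_or_eq with hm | rfl
      swap; · linarith
      refine lt_of_le_of_ne (hmin m hm).2 fun he => ?_
      have hp0 : 0 ≤ (X q m).2 := by
        rcases m with _ | m
        · have : q = Real.pi := he
          rw [hX0]; simp only; rw [this]; exact hσπ.le
        · have h1 := (hmin m (by omega)).2
          have h2 := hq q m
          by_contra hneg; push Not at hneg
          nlinarith
      have := up q m he hp0
      rcases (Nat.succ_le_of_lt hm).lt_or_eq with hm' | hm'
      · linarith [(hmin _ hm').2]
      · rw [← hm', Nat.succ_eq_add_one] at hc; linarith
    · right
      refine mem_iUnion.2 ⟨n, hc, fun m hm => ?_⟩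
      rcases hm.lt_or_eq with hm | rfl
      swap; · linarith
      refine lt_of_le_of_ne (hmin m hm).1 fun he => ?_
      have hp0 : (X q m).2 ≤ 0 := by
        rcases m with _ | m
        · have : 0 = q := he
          rw [hX0]; simp only; rw [← this]; exact hσ0.le
        · have h1 := (hmin m (by omega)).1
          have h2 := hq q m
          by_contra hneg; push Not at hneg
          nlinarith
      have := dn q m he.symm hp0
      rcases (Nat.succ_le_of_lt hm).lt_or_eq with hm' | hm'
      · linarith [(hmin _ hm').1]
      · rw [← hm', Nat.succ_eq_add_one] at hc; linarith
  have hmu : (0 : ℝ) ∈ u := by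
    have h1 := dn 0 0 rfl hσ0.le
    refine mem_iUnion.2 ⟨1, h1, fun m hm => ?_⟩
    interval_cases m
    · exact hpi
    · exact h1.trans hpi
  have hmv : Real.pi ∈ v := by
    have h1 := up Real.pi 0 rfl hσπ.le
    refine mem_iUnion.2 ⟨1, h1, fun m hm => ?_⟩
    interval_cases m
    · exact hpi
    · exact hpi.trans h1
  obtain ⟨q, -, hqu, hqv⟩ := isPreconnected_Icc u v hu hv hcov
    ⟨0, ⟨le_rfl, hpi.le⟩, hmu⟩ ⟨Real.pi, ⟨hpi.le, le_rfl⟩, hmv⟩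
  obtain ⟨n, hn1, hn2⟩ := mem_iUnion.1 hqu
  obtain ⟨m, hm1, hm2⟩ := mem_iUnion.1 hqv
  rcases le_total n m with hnm | hnm
  · linarith [hm2 n hnm]
  · linarith [hn2 m hnm]

lemma Ad_abs {l g : ℝ} (hl : 0 < l) (hg : 0 < g) (a : ℝ → ℝ) {q t Ab : ℝ} (hA : |a t| ≤ Ab) :
    |Ad l g a q t| ≤ (Ab + g) / l := by
  have h1 := Real.abs_sin_le_one q
  have h2 := Real.abs_cos_le_one q
  have : Ad l g a q t = (a t * Real.sin q - g * Real.cos q) / l := by unfold Ad; ring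
  rw [this, abs_div, abs_of_pos hl]
  refine div_le_div_of_nonneg_right ?_ hl.le
  refine (abs_sub _ _).trans ?_
  rw [abs_mul, abs_mul, abs_of_pos hg]
  nlinarith [abs_nonneg (a t), abs_nonneg (Real.sin q)]

lemma Cd_le {l g μ : ℝ} (hl : 0 < l) (hg : 0 < g) (hμ : 0 < μ) (a : ℝ → ℝ) {q p t Ab B : ℝ}
    (hA : |a t| ≤ Ab) (hB : |p| ≤ B) :
    Cd l g μ a q p t ≤ μ / l * (Ab + l * B ^ 2 + g) := by
  have h1 := Real.abs_sin_le_one q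
  have h2 := Real.abs_cos_le_one q
  unfold Cd
  refine mul_le_mul_of_nonneg_left ?_ (by positivity)
  refine (abs_add_le _ _).trans (add_le_add ((abs_sub _ _).trans (add_le_add ?_ ?_)) ?_)
  · rw [abs_mul]; nlinarith [abs_nonneg (a t)]
  · rw [abs_of_nonneg (by positivity)]
    refine mul_le_mul_of_nonneg_left ?_ hl.le
    rw [← sq_abs]
    exact pow_le_pow_left₀ (abs_nonneg _) hB 2
  · rw [abs_mul, abs_of_pos hg]; nlinarith

lemma sch_bound {l g μ : ℝ} (hl : 0 < l) (hg : 0 < g) (hμ : 0 < μ)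
    (a : ℝ → ℝ) {t₀ h T Ab S : ℝ} (hh : 0 < h) (hA : ∀ t ∈ Icc t₀ T, |a t| ≤ Ab) (hAb : 0 ≤ Ab)
    (x : ℝ × ℝ) (hx : |x.2| ≤ S) (k : ℕ) (hk : t₀ + k * h ≤ T) :
    |(sch l g μ a t₀ h x k).2| ≤ S + (T - t₀) * ((Ab + g) / l) := by
  have key : |(sch l g μ a t₀ h x k).2| ≤ S + k * h * ((Ab + g) / l) := by
    induction k with
    | zero => simpa [sch] using hx
    | succ k ih =>
      push_cast at hk ⊢
      have hk0 : 0 ≤ (k : ℝ) * h := by positivity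
      have ih := ih (by linarith)
      simp only [sch]
      have e1 := Ad_abs hl hg a (q := (sch l g μ a t₀ h x k).1) (hA (t₀ + k * h) ⟨by linarith, by linarith⟩)
      unfold stp
      refine (abs_add_le _ _).trans ?_
      have e2 := clp_sub_abs (mul_nonneg hh.le (Cd_nonneg (g := g) hl hμ a
        (sch l g μ a t₀ h x k).1 (sch l g μ a t₀ h x k).2 (t₀ + k * h))) (sch l g μ a t₀ h x k).2
      rw [abs_mul, abs_of_pos hh]
      nlinarith
  have : (k : ℝ) * h * ((Ab + g) / l) ≤ (T - t₀) * ((Ab + g) / l) :=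
    mul_le_mul_of_nonneg_right (by linarith) (by positivity)
  linarith

lemma stp_sub {l g μ : ℝ} (hl : 0 < l) (hg : 0 < g) (hμ : 0 < μ) (a : ℝ → ℝ) {h t q p Ab B : ℝ}
    (hh : 0 < h) (hA : |a t| ≤ Ab) (hB : |p| ≤ B) :
    |stp l g μ a h t q p - p| ≤ ((Ab + g) / l + μ / l * (Ab + l * B ^ 2 + g)) * h := by
  have e : stp l g μ a h t q p - p = h * Ad l g a q t - clp (h * Cd l g μ a q p t) p := by
    unfold stp; ring
  rw [e]
  refine (abs_sub _ _).trans ?_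
  have e1 := Ad_abs hl hg a (q := q) hA
  have e2 := Cd_le hl hg hμ a (q := q) hA hB
  have e3 := clp_abs (mul_nonneg hh.le (Cd_nonneg (g := g) hl hμ a q p t)) p
  rw [abs_mul, abs_of_pos hh]
  nlinarith

lemma ub_of_tendsto {t₀ t : ℝ} {h : ℕ → ℝ} (hpos : ∀ n, 0 < h n) {D F : ℕ × ℕ → ℝ} {U : ℝ}
    (hD : ∀ᶠ z in lf t₀ h t, D z ≤ h z.1 * F z) (hF : Tendsto F (lf t₀ h t) (nhds U)) :
    ∀ η > 0, ∀ᶠ z in lf t₀ h t, D z ≤ h z.1 * (U + η) := by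
  intro η hη
  filter_upwards [hD, hF.eventually (gt_mem_nhds (show U < U + η by linarith))] with z h1 h2
  exact h1.trans (mul_le_mul_of_nonneg_left h2.le (hpos _).le)

lemma lb_of_tendsto {t₀ t : ℝ} {h : ℕ → ℝ} (hpos : ∀ n, 0 < h n) {D F : ℕ × ℕ → ℝ} {U : ℝ}
    (hD : ∀ᶠ z in lf t₀ h t, h z.1 * F z ≤ D z) (hF : Tendsto F (lf t₀ h t) (nhds U)) :
    ∀ η > 0, ∀ᶠ z in lf t₀ h t, h z.1 * (U - η) ≤ D z := by
  intro η hη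
  filter_upwards [hD, hF.eventually (lt_mem_nhds (show U - η < U by linarith))] with z h1 h2
  exact (mul_le_mul_of_nonneg_left h2.le (hpos _).le).trans h1

lemma hRHS_eq (l g μ : ℝ) (a : ℝ → ℝ) (q p t s : ℝ) :
    hRHS l g μ a q p t s = Ad l g a q t - Cd l g μ a q p t * s := by
  unfold hRHS Ad Cd; ring


lemma Ad_tendsto {l g : ℝ} {a : ℝ → ℝ} (ha : Continuous a) {f : Filter (ℕ × ℕ)}
    {q t : ℕ × ℕ → ℝ} {q' t' : ℝ} (hq : Tendsto q f (nhds q')) (ht : Tendsto t f (nhds t')) :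
    Tendsto (fun z => Ad l g a (q z) (t z)) f (nhds (Ad l g a q' t')) := by
  unfold Ad
  have h1 := (ha.tendsto t').comp ht
  have h2 := (Real.continuous_sin.tendsto q').comp hq
  have h3 := (Real.continuous_cos.tendsto q').comp hq
  exact ((h1.div_const l).mul h2).sub (h3.const_mul (g / l))

lemma Cd_tendsto {l g μ : ℝ} {a : ℝ → ℝ} (ha : Continuous a) {f : Filter (ℕ × ℕ)}
    {q p t : ℕ × ℕ → ℝ} {q' p' t' : ℝ} (hq : Tendsto q f (nhds q')) (hp : Tendsto p f (nhds p'))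
    (ht : Tendsto t f (nhds t')) :
    Tendsto (fun z => Cd l g μ a (q z) (p z) (t z)) f (nhds (Cd l g μ a q' p' t')) := by
  unfold Cd
  have h1 := (ha.tendsto t').comp ht
  have h2 := (Real.continuous_sin.tendsto q').comp hq
  have h3 := (Real.continuous_cos.tendsto q').comp hq
  exact ((((h1.mul h3).sub ((hp.pow 2).const_mul l)).add (h2.const_mul g)).abs).const_mul (μ / l)

/-- **A solution without falling starting on a given curve of initial conditions.** Let
`σ : [0, π] → ℝ` be continuous with `σ 0 < 0` and `σ π > 0`. Then there is `q₀ ∈ [0, π]`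
such that some solution of the pendulum differential inclusion `(q̇, ṗ) ∈ Φ (q, p, t)` on
`[t₀, ∞)` with `q (t₀) = q₀`, `p (t₀) = σ q₀` satisfies `q (t) ∈ [0, π]` for all
`t ≥ t₀`. -/
theorem stmt11 (l g μ : ℝ) (hl : 0 < l) (hg : 0 < g) (hμ : 0 < μ)
    (a : ℝ → ℝ) (K : NNReal) (ha : LipschitzWith K a) (t₀ : ℝ)
    (σ : ℝ → ℝ) (hσ : ContinuousOn σ (Set.Icc 0 Real.pi))
    (hσ0 : σ 0 < 0) (hσπ : σ Real.pi > 0) :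
    ∃ q₀ ∈ Set.Icc (0 : ℝ) Real.pi, ∃ x : ℝ → ℝ × ℝ,
      x t₀ = (q₀, σ q₀) ∧
      IsDISolution (fun z t => Phi l g μ a z.1 z.2 t) (Set.Ici t₀) t₀ x ∧
      ∀ t ≥ t₀, (x t).1 ∈ Set.Icc (0 : ℝ) Real.pi := by
  classical
  have hpi := Real.pi_pos
  -- extension of `σ`
  obtain ⟨σ', hσ'c, hσ'e⟩ : ∃ σ' : ℝ → ℝ, Continuous σ' ∧ ∀ q ∈ Icc 0 Real.pi, σ' q = σ q := by
    refine ⟨IccExtend hpi.le ((Icc 0 Real.pi).domRestrict σ), ?_, ?_⟩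
    · exact (continuousOn_iff_continuous_domRestrict.1 hσ).Icc_extend'
    · intro q hq
      rw [IccExtend_of_mem _ _ hq]; rfl
  have hac : Continuous a := ha.continuous
  set h : ℕ → ℝ := fun n => 1 / ((n : ℝ) + 1) with hh
  have hpos : ∀ n, 0 < h n := fun n => by positivity
  have h0 : Tendsto h atTop (nhds 0) := tendsto_one_div_add_atTop_nhds_zero_nat
  have hst := fun n => exists_stay hl hg hμ a t₀ (h n) (hpos n) σ' hσ'c
    (by rw [hσ'e 0 ⟨le_rfl, hpi.le⟩]; exact hσ0)
    (by rw [hσ'e Real.pi ⟨hpi.le, le_rfl⟩]; exact hσπ)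
  choose q0 hq0 hstay using hst
  set Q : ℕ → ℕ → ℝ := fun n k => (sch l g μ a t₀ (h n) (q0 n, σ' (q0 n)) k).1 with hQ
  set P : ℕ → ℕ → ℝ := fun n k => (sch l g μ a t₀ (h n) (q0 n, σ' (q0 n)) k).2 with hP
  have hQs : ∀ n k, Q n (k + 1) = Q n k + h n * P n (k + 1) := fun n k => rfl
  have hPs : ∀ n k, P n (k + 1) = stp l g μ a (h n) (t₀ + k * h n) (Q n k) (P n k) :=
    fun n k => rfl
  obtain ⟨S, hS⟩ := isCompact_Icc.exists_bound_of_continuousOn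
    (hσ'c.continuousOn (s := Icc 0 Real.pi))
  have hP0 : ∀ n, |P n 0| ≤ S := fun n => hS _ (hq0 n)
  have hbd : ∀ T, ∃ Ab B, 0 ≤ Ab ∧ (∀ t ∈ Icc t₀ T, |a t| ≤ Ab) ∧
      ∀ n (k : ℕ), t₀ + k * h n ≤ T → |P n k| ≤ B := by
    intro T
    obtain ⟨A, hA⟩ := isCompact_Icc.exists_bound_of_continuousOn
      (hac.continuousOn (s := Icc t₀ T))
    have hA' : ∀ t ∈ Icc t₀ T, |a t| ≤ |A| := fun t ht => (hA t ht).trans (le_abs_self _)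
    exact ⟨|A|, S + (T - t₀) * ((|A| + g) / l), abs_nonneg _, hA', fun n k hk =>
      sch_bound hl hg hμ a (hpos n) hA' (abs_nonneg _) _ (hP0 n) k hk⟩
  have hstayQ : ∀ n k, Q n k ∈ Icc 0 Real.pi := hstay
  have hPQ0 : ∀ n, σ' (Q n 0) = P n 0 := fun n => rfl
  clear_value Q P h
  obtain ⟨p, hplip, hp⟩ := limit_lemma t₀ h hpos h0 P S hP0 (by
    intro T
    obtain ⟨Ab, B, hAb, hA, hB⟩ := hbd T
    refine ⟨(Ab + g) / l + μ / l * (Ab + l * B ^ 2 + g), by positivity, fun n k hk => ?_⟩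
    have hk0 : 0 ≤ (k : ℝ) * h n := mul_nonneg (by positivity) (hpos n).le
    have hk1 : t₀ + k * h n ≤ T := by nlinarith [hpos n]
    rw [hPs]
    exact stp_sub hl hg hμ a (hpos n) (hA _ ⟨by linarith, hk1⟩) (hB n k hk1))
  obtain ⟨q, hqlip, hq⟩ := limit_lemma t₀ h hpos h0 Q Real.pi (fun n => by
      have := hstayQ n 0
      rw [abs_le]; exact ⟨by linarith [this.1], this.2⟩) (by
    intro T
    obtain ⟨Ab, B, hAb, hA, hB⟩ := hbd T
    refine ⟨|B|, abs_nonneg _, fun n k hk => ?_⟩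
    have := hB n (k + 1) (by push_cast; exact hk)
    rw [hQs, add_sub_cancel_left, abs_mul, abs_of_pos (hpos n), mul_comm]
    exact mul_le_mul_of_nonneg_right (this.trans (le_abs_self _)) (hpos n).le)
  have hqmem : ∀ t ≥ t₀, q t ∈ Icc 0 Real.pi := fun t ht =>
    isClosed_Icc.mem_of_tendsto ((hq t ht).comp (flr_lf hpos h0 ht))
      (Eventually.of_forall fun n => hstayQ n _)
  have hinit : σ (q t₀) = p t₀ := by
    have hz : ∀ n, flr t₀ h n t₀ = 0 := fun n => by simp [flr]
    have e1 := (hq t₀ le_rfl).comp (flr_lf hpos h0 le_rfl)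
    have e2 := (hp t₀ le_rfl).comp (flr_lf hpos h0 le_rfl)
    have e3 := (hσ'c.tendsto (q t₀)).comp e1
    rw [← hσ'e _ (hqmem t₀ le_rfl)]
    refine tendsto_nhds_unique e3 (e2.congr fun n => ?_)
    simp only [Function.comp, hz]
    exact (hPQ0 n).symm
  have hpac := ac_of_lip hplip
  have hqac := ac_of_lip hqlip
  have hpint := locInt_deriv hpac
  have hqint := locInt_deriv hqac
  refine ⟨q t₀, hqmem t₀ le_rfl, fun t => (q t, p t), by rw [hinit], ?_, hqmem⟩
  refine ⟨fun t => (deriv q t, deriv p t), ?_, ?_, ?_⟩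
  · intro x
    obtain ⟨s1, hs1, i1⟩ := hqint x
    obtain ⟨s2, hs2, i2⟩ := hpint x
    exact ⟨s1 ∩ s2, inter_mem hs1 hs2,
      Integrable.prodMk (i1.mono_set inter_subset_left) (i2.mono_set inter_subset_right)⟩
  · intro t _
    have i1 := (hqac t₀ t).intervalIntegrable_deriv
    have i2 := (hpac t₀ t).intervalIntegrable_deriv
    have e : ∫ s in t₀..t, (deriv q s, deriv p s) =
        (∫ s in t₀..t, deriv q s, ∫ s in t₀..t, deriv p s) := by
      rw [intervalIntegral.intervalIntegral_eq_integral_uIoc,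
        intervalIntegral.intervalIntegral_eq_integral_uIoc,
        intervalIntegral.intervalIntegral_eq_integral_uIoc,
        integral_pair i1.def' i2.def']
      rfl
    rw [e, (hqac t₀ t).integral_deriv_eq_sub, (hpac t₀ t).integral_deriv_eq_sub]
    simp
  · rw [ae_restrict_iff' measurableSet_Ici]
    filter_upwards [ae_diff hqac, ae_diff hpac] with t hqd hpd ht
    have ht : t₀ ≤ t := ht
    have hqd := hqd.hasDerivAt
    have hpd := hpd.hasDerivAt
    have hdq : deriv q t = p t := by
      have hF : Tendsto (fun z : ℕ × ℕ => P z.1 (z.2 + 1)) (lf t₀ h t) (nhds (p t)) :=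
        (hp t ht).comp (lf_shift h0)
      refine le_antisymm ?_ ?_
      · exact upper_deriv hpos h0 hq ht (ub_of_tendsto hpos
          (Eventually.of_forall fun z => by rw [hQs]; linarith) hF) hqd
      · exact lower_deriv hpos h0 hq ht (lb_of_tendsto hpos
          (Eventually.of_forall fun z => by rw [hQs]; linarith) hF) hqd
    have hA : Tendsto (fun z : ℕ × ℕ => Ad l g a (Q z.1 z.2) (t₀ + z.2 * h z.1)) (lf t₀ h t)
        (nhds (Ad l g a (q t) t)) := by
      exact Ad_tendsto hac (hq t ht) lf_time
    have hC : Tendsto (fun z : ℕ × ℕ => Cd l g μ a (Q z.1 z.2) (P z.1 z.2) (t₀ + z.2 * h z.1))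
        (lf t₀ h t) (nhds (Cd l g μ a (q t) (p t) t)) := by
      exact Cd_tendsto hac (hq t ht) (hp t ht) lf_time
    have hhC := (lf_h (t₀ := t₀) (t := t) h0).mul hC
    rw [zero_mul] at hhC
    have hinc : ∀ z : ℕ × ℕ, P z.1 (z.2 + 1) - P z.1 z.2 =
        h z.1 * Ad l g a (Q z.1 z.2) (t₀ + z.2 * h z.1) -
        clp (h z.1 * Cd l g μ a (Q z.1 z.2) (P z.1 z.2) (t₀ + z.2 * h z.1)) (P z.1 z.2) := by
      intro z; rw [hPs, stp]; ring
    have hcn : ∀ z : ℕ × ℕ,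
        0 ≤ h z.1 * Cd l g μ a (Q z.1 z.2) (P z.1 z.2) (t₀ + z.2 * h z.1) := fun z =>
      mul_nonneg (hpos _).le (Cd_nonneg hl hμ _ _ _ _)
    simp only [Phi]
    rw [hdq]
    rcases lt_trichotomy (p t) 0 with hpt | hpt | hpt
    · rw [if_pos hpt.ne, mem_singleton_iff, abs_of_neg hpt, div_neg, div_self hpt.ne, hRHS_eq]
      have hev : ∀ᶠ z in lf t₀ h t, P z.1 (z.2 + 1) - P z.1 z.2 =
          h z.1 * (Ad l g a (Q z.1 z.2) (t₀ + z.2 * h z.1) +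
            Cd l g μ a (Q z.1 z.2) (P z.1 z.2) (t₀ + z.2 * h z.1)) := by
        have := ((hp t ht).add hhC).eventually (gt_mem_nhds (show p t + 0 < 0 by linarith))
        filter_upwards [this] with z hz
        rw [hinc, clp_small (by linarith)]; ring
      have h1 := upper_deriv hpos h0 hp ht (ub_of_tendsto hpos (hev.mono fun z hz => hz.le)
        (hA.add hC)) hpd
      have h2 := lower_deriv hpos h0 hp ht (lb_of_tendsto hpos (hev.mono fun z hz => hz.ge)
        (hA.add hC)) hpd
      ext
      · rfl
      · simp only; linarith
    · rw [hpt, if_neg (by simp)]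
      rw [hpt] at hC
      have h1 := upper_deriv hpos h0 hp ht (ub_of_tendsto hpos (Eventually.of_forall fun z => by
        rw [hinc]
        have := abs_le.1 (clp_abs (hcn z) (P z.1 z.2))
        rw [mul_add]
        linarith) (hA.add hC)) hpd
      have h2 := lower_deriv hpos h0 hp ht (lb_of_tendsto hpos (Eventually.of_forall fun z => by
        rw [hinc]
        have := abs_le.1 (clp_abs (hcn z) (P z.1 z.2))
        rw [mul_sub]
        linarith) (hA.sub hC)) hpd
      have hC0 := Cd_nonneg (g := g) hl hμ a (q t) 0 t
      rcases hC0.eq_or_lt with hz | hz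
      · refine ⟨0, by simp, ?_⟩
        rw [hRHS_eq]
        ext
        · rfl
        · simp only; rw [← hz] at h1 h2 ⊢; linarith
      · refine ⟨(Ad l g a (q t) t - deriv p t) / Cd l g μ a (q t) 0 t, ⟨?_, ?_⟩, ?_⟩
        · rw [le_div_iff₀ hz]; linarith
        · rw [div_le_iff₀ hz]; linarith
        · rw [hRHS_eq, mul_div_cancel₀ _ hz.ne']
          ext
          · rfl
          · simp only; ring
    · rw [if_pos hpt.ne', mem_singleton_iff, abs_of_pos hpt, div_self hpt.ne', hRHS_eq]
      have hev : ∀ᶠ z in lf t₀ h t, P z.1 (z.2 + 1) - P z.1 z.2 =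
          h z.1 * (Ad l g a (Q z.1 z.2) (t₀ + z.2 * h z.1) -
            Cd l g μ a (Q z.1 z.2) (P z.1 z.2) (t₀ + z.2 * h z.1)) := by
        have := ((hp t ht).sub hhC).eventually (lt_mem_nhds (show 0 < p t - 0 by linarith))
        filter_upwards [this] with z hz
        rw [hinc, clp_big (hcn z) (by linarith)]; ring
      have h1 := upper_deriv hpos h0 hp ht (ub_of_tendsto hpos (hev.mono fun z hz => hz.le)
        (hA.sub hC)) hpd
      have h2 := lower_deriv hpos h0 hp ht (lb_of_tendsto hpos (hev.mono fun z hz => hz.ge)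
        (hA.sub hC)) hpd
      ext
      · rfl
      · simp only; linarith
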